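/- Let p, q be distinct primes with q > 5, let z = z(q) be the entry point of q in the Fibonacci sequence, and let n ≥ 1. Then the generalized Fibonacci–Lucas quaternion G^{p,q}_n is a zero divisor in H[Z_q] (equivalently, not a unit) if and only if there exists a natural number l with 2n + 1 = (2l + 1)·z. -/

import Mathlib

open Quaternion

/-- The Lucas sequence, as integers: `l_n = 2·f_{n+1} - f_n`
(equivalently `l_0 = 2`, `l_1 = 1`, `l_{n+2} = l_{n+1} + l_n`). -/
def lucas (n : ℕ) : ℤ := 2 * (Nat.fib (n + 1) : ℤ) - (Nat.fib n : ℤ)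

/-- The generalized Fibonacci–Lucas numbers `g^{p,q}_n = p·f_{n-1} + q·l_n` (for `n ≥ 1`). -/
def genFL (p q : ℤ) (n : ℕ) : ℤ := p * (Nat.fib (n - 1) : ℤ) + q * lucas n

/-- The n-th generalized Fibonacci–Lucas quaternion over a commutative ring `R`:
`G^{p,q}_n = g^{p,q}_n + g^{p,q}_{n+1}·i + g^{p,q}_{n+2}·j + g^{p,q}_{n+3}·k` in `ℍ[R]`. -/
def genFLQuat (R : Type*) [CommRing R] (p q : ℤ) (n : ℕ) : ℍ[R] :=
  ⟨(genFL p q n : R), (genFL p q (n + 1) : R), (genFL p q (n + 2) : R), (genFL p q (n + 3) : R)⟩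

/-- A quaternion over a commutative ring is a unit iff its norm is. -/
theorem Quaternion.isUnit_iff_isUnit_normSq {R : Type*} [CommRing R] (x : ℍ[R]) :
    IsUnit x ↔ IsUnit (normSq x) := by
  refine ⟨fun h => h.map normSq, fun h => ?_⟩
  obtain ⟨c, hc⟩ := h.exists_right_inv
  have hcoe : ((normSq x : R) : ℍ[R]) * (c : ℍ[R]) = 1 := by
    rw [← coe_mul, hc, coe_one]
  refine isUnit_iff_exists.mpr ⟨star x * (c : ℍ[R]), ?_, ?_⟩
  · rw [← mul_assoc, self_mul_star, hcoe]
  · rw [← coe_commutes, mul_assoc, star_mul_self, coe_commutes, hcoe]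

/-- The entry point `z` of `q` divides exactly the indices `m` with `q ∣ fib m`. -/
theorem Nat.dvd_fib_iff_of_isLeast {q z : ℕ} (hz : IsLeast {m | 0 < m ∧ q ∣ fib m} z) (m : ℕ) :
    q ∣ fib m ↔ z ∣ m := by
  refine ⟨fun h => ?_, fun h => hz.1.2.trans (fib_dvd z m h)⟩
  have hle : z ≤ z.gcd m :=
    hz.2 ⟨gcd_pos_of_pos_left m hz.1.1, fib_gcd z m ▸ dvd_gcd hz.1.2 h⟩
  rw [← (gcd_le_left m hz.1.1).antisymm hle]
  exact gcd_dvd_right z m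

theorem normSq_genFLQuat_zmod (p : ℤ) (q n : ℕ) (hn : 1 ≤ n) :
    normSq (genFLQuat (ZMod q) p q n) = 3 * (p : ZMod q) ^ 2 * (Nat.fib (2 * n + 1) : ZMod q) := by
  obtain ⟨m, rfl⟩ := Nat.exists_eq_add_of_le' hn
  rw [normSq_def', Nat.fib_two_mul_add_one]
  simp only [genFLQuat, genFL, Nat.add_sub_cancel, Nat.add_succ_sub_one]
  push_cast
  simp only [CharP.cast_eq_zero, zero_mul, add_zero, Nat.fib_add_two, Nat.add_assoc,
    Nat.reduceAdd]
  push_cast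
  ring

theorem genFLQuat_zmod_q_zeroDivisor_iff (p q : ℕ) (hp : p.Prime) (hq : q.Prime)
    (hne : p ≠ q) (hq5 : 5 < q) (z : ℕ) (hz : IsLeast {m | 0 < m ∧ q ∣ Nat.fib m} z)
    (n : ℕ) (hn : 1 ≤ n) :
    ¬ IsUnit (genFLQuat (ZMod q) (p : ℤ) (q : ℤ) n) ↔
      ∃ l : ℕ, 2 * n + 1 = (2 * l + 1) * z := by
  have : Fact q.Prime := ⟨hq⟩
  have hp0 : (p : ZMod q) ≠ 0 := by
    rw [Ne, ZMod.natCast_eq_zero_iff, Nat.prime_dvd_prime_iff_eq hq hp]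
    exact hne.symm
  have h3 : (3 : ZMod q) ≠ 0 := by
    have h : ((3 : ℕ) : ZMod q) ≠ 0 := by
      rw [Ne, ZMod.natCast_eq_zero_iff]
      exact Nat.not_dvd_of_pos_of_lt (by norm_num) (by omega)
    exact_mod_cast h
  rw [Quaternion.isUnit_iff_isUnit_normSq, isUnit_iff_ne_zero, not_not,
    normSq_genFLQuat_zmod _ _ _ hn, Int.cast_natCast,
    mul_eq_zero_iff_left (mul_ne_zero h3 (pow_ne_zero 2 hp0)),
    ZMod.natCast_eq_zero_iff, Nat.dvd_fib_iff_of_isLeast hz]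
  constructor
  · rintro ⟨k, hk⟩
    have hodd : Odd (z * k) := hk ▸ odd_two_mul_add_one n
    obtain ⟨l, rfl⟩ := (Nat.odd_mul.mp hodd).2
    exact ⟨l, by rw [hk, mul_comm]⟩
  · rintro ⟨l, hl⟩
    exact hl ▸ dvd_mul_left z (2 * l + 1)
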